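/- The minimax mean-squared error of estimating the missing mass from a length-n output of a geometric sticky channel with parameter α is lower bounded: R*_{n,α} ≥ (1/32)/(1 + (n−1)(1−α)) − (1 − 0.5(1−α))^{n−1}. -/

import Mathlib

open scoped Classical

/-- The probability that the stationary geometric-sticky Markov chain with stickiness
parameter `α` and base distribution `p` (i.e. `X_1 ~ p` and
`Pr(X_i = z | X_{i-1} = y) = α·1[z=y] + (1-α)·p z`) produces the sample path `x`. -/
noncomputable def stickyProb {X : Type*} [DecidableEq X] (α : ℝ) (p : X → ℝ) {n : ℕ}
    (x : Fin n → X) : ℝ :=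
  (if h : 0 < n then p (x ⟨0, h⟩) else 1) *
  ∏ i : Fin n, if i.val = 0 then 1 else
    ((if x i = x ⟨i.val - 1, lt_of_le_of_lt (Nat.pred_le _) i.isLt⟩ then α else 0)
      + (1 - α) * p (x i))

/-- The missing mass of the sample path `x` under a (finitely supported) distribution `p`
on the countable alphabet `ℕ`. -/
noncomputable def missingMassNat (p : ℕ → ℝ) {n : ℕ} (x : Fin n → ℕ) : ℝ :=
  ∑' a : ℕ, p a * (if ∀ i, x i ≠ a then 1 else 0)

open Finset in
lemma sticky_snoc (α : ℝ) (p : ℕ → ℝ) (m : ℕ) (x : Fin (m+1) → ℕ) (z : ℕ) :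
    stickyProb α p (Fin.snoc x z : Fin (m+2) → ℕ) = stickyProb α p x *
      ((if z = x (Fin.last m) then α else 0) + (1 - α) * p z) := by
  unfold stickyProb
  rw [Fin.prod_univ_castSucc (n := m+1), ← mul_assoc]
  congr 1
  · congr 1
    · apply Finset.prod_congr rfl
      intro i _
      by_cases h : i.val = 0
      · simp [h]
      · have e : (⟨(i.castSucc).val - 1, lt_of_le_of_lt (Nat.pred_le _) i.castSucc.isLt⟩ : Fin (m+2)) = Fin.castSucc ⟨i.val - 1, lt_of_le_of_lt (Nat.pred_le _) i.isLt⟩ := by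
          ext; simp
        rw [e]
        simp only [Fin.snoc_castSucc, Fin.val_castSucc]
  · have e : (⟨(Fin.last (m+1)).val - 1, lt_of_le_of_lt (Nat.sub_le _ _) (Fin.last (m+1)).isLt⟩ : Fin (m+2)) = Fin.castSucc (Fin.last m) := by
      ext; simp
    rw [e]
    simp only [Fin.snoc_castSucc, Fin.snoc_last]
    simp

open Finset in
lemma sticky_sum (α : ℝ) (p : ℕ → ℝ) (S : Finset ℕ) (m : ℕ) :
    ∑ x ∈ Fintype.piFinset (fun _ : Fin (m+1) => S), stickyProb α p x
      = (∑ a ∈ S, p a) * (α + (1 - α) * ∑ a ∈ S, p a) ^ m := by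
  induction m with
  | zero =>
    simp only [pow_zero, mul_one]
    refine Finset.sum_nbij' (fun x => x 0) (fun a _ => a) ?_ ?_ ?_ ?_ ?_
    · intro x hx; exact Fintype.mem_piFinset.1 hx 0
    · intro a ha; exact Fintype.mem_piFinset.2 (fun _ => ha)
    · intro x hx; ext i; exact congrArg x (Fin.ext (by have := i.2; simp only [Fin.val_zero]; omega))
    · intro a ha; rfl
    · intro x hx; simp [stickyProb]
  | succ m ih =>
    have : ∑ x ∈ Fintype.piFinset (fun _ : Fin (m+2) => S), stickyProb α p x
        = ∑ y ∈ (Fintype.piFinset (fun _ : Fin (m+1) => S)) ×ˢ S,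
          stickyProb α p (Fin.snoc y.1 y.2 : Fin (m+2) → ℕ) := by
      symm
      refine Finset.sum_nbij' (fun y => (Fin.snoc y.1 y.2 : Fin (m+2) → ℕ))
        (fun x => (fun i => x i.castSucc, x (Fin.last _))) ?_ ?_ ?_ ?_ ?_
      · rintro ⟨x, z⟩ h
        rw [Finset.mem_product] at h
        rw [Fintype.mem_piFinset]
        intro i
        refine Fin.lastCases ?_ (fun j => ?_) i
        · simpa using h.2
        · simpa using Fintype.mem_piFinset.1 h.1 j
      · intro x h
        rw [Fintype.mem_piFinset] at h
        rw [Finset.mem_product]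
        exact ⟨Fintype.mem_piFinset.2 fun i => h _, h _⟩
      · rintro ⟨x, z⟩ h
        simp
      · intro x h
        ext i
        refine Fin.lastCases ?_ (fun j => ?_) i <;> simp
      · intro _ _; rfl
    rw [this, Finset.sum_product, pow_succ, ← mul_assoc, ← ih, Finset.sum_mul]
    refine Finset.sum_congr rfl fun x hx => ?_
    simp only [sticky_snoc]
    rw [← Finset.mul_sum, Finset.sum_add_distrib, ← Finset.mul_sum, Finset.sum_ite_eq',
      if_pos (Fintype.mem_piFinset.1 hx _)]

lemma sticky_zero (α : ℝ) (p : ℕ → ℝ) (S : Finset ℕ) (hp : ∀ a, a ∉ S → p a = 0) (n : ℕ)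
    (x : Fin n → ℕ) (hx : stickyProb α p x ≠ 0) : x ∈ Fintype.piFinset (fun _ : Fin n => S) := by
  rw [Fintype.mem_piFinset]
  unfold stickyProb at hx
  obtain ⟨h1, h2⟩ := mul_ne_zero_iff.1 hx
  rw [Finset.prod_ne_zero_iff] at h2
  have key : ∀ k : ℕ, ∀ h : k < n, x ⟨k, h⟩ ∈ S := by
    intro k
    induction k with
    | zero =>
      intro h
      rw [dif_pos h] at h1
      by_contra hc
      exact h1 (hp _ hc)
    | succ k ih =>
      intro h
      have := h2 ⟨k+1, h⟩ (Finset.mem_univ _)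
      have ih' := ih (by omega)
      by_contra hc
      apply this
      have e : (⟨k + 1 - 1, lt_of_le_of_lt (Nat.sub_le _ _) h⟩ : Fin n) = ⟨k, by omega⟩ := by
        ext; simp
      have hne : x ⟨k+1, h⟩ ≠ x ⟨k, by omega⟩ := fun hh => hc (hh ▸ ih')
      simp [hne, hp _ hc]
  exact fun i => key i.1 i.2

lemma sticky_nonneg (α : ℝ) (hα0 : 0 ≤ α) (hα1 : α < 1) (p : ℕ → ℝ) (hp : ∀ a, 0 ≤ p a) (n : ℕ)
    (x : Fin n → ℕ) : 0 ≤ stickyProb α p x := by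
  unfold stickyProb
  apply mul_nonneg
  · split_ifs
    · exact hp _
    · exact zero_le_one
  · apply Finset.prod_nonneg
    intro i _
    have := mul_nonneg (sub_nonneg.2 hα1.le) (hp (x i))
    split_ifs <;> linarith

lemma sticky_sq_le (α : ℝ) (hα0 : 0 ≤ α) (hα1 : α < 1) (p q g : ℕ → ℝ) (hp : ∀ a, 0 ≤ p a)
    (hq : ∀ a, 0 ≤ q a) (hg : ∀ a, 0 ≤ g a) (h : ∀ a, g a ^ 2 = p a * q a) (n : ℕ)
    (x : Fin n → ℕ) : (stickyProb α g x) ^ 2 ≤ stickyProb α p x * stickyProb α q x := by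
  unfold stickyProb
  rw [mul_pow, mul_mul_mul_comm, ← Finset.prod_pow, ← Finset.prod_mul_distrib]
  apply mul_le_mul
  · split_ifs
    · exact (h _).le
    · simp
  · apply Finset.prod_le_prod
    · intro i _; positivity
    · intro i _
      have h1 := h (x i)
      have h2 : 2 * g (x i) ≤ p (x i) + q (x i) := by
        apply le_of_sq_le_sq _ (add_nonneg (hp _) (hq _))
        nlinarith [sq_nonneg (p (x i) - q (x i))]
      have key : ∀ A : ℝ, 0 ≤ A → (A + (1 - α) * g (x i)) ^ 2 ≤
          (A + (1 - α) * p (x i)) * (A + (1 - α) * q (x i)) := by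
        intro A hA
        have := mul_le_mul_of_nonneg_left h2 (mul_nonneg hA (sub_nonneg.2 hα1.le))
        have h3 : (1-α)^2 * g (x i)^2 = (1-α)^2 * (p (x i) * q (x i)) := by rw [h1]
        nlinarith
      by_cases h0 : i.val = 0
      · simp [h0]
      · simp only [h0, if_false]
        apply key
        split_ifs <;> simp [hα0]
  · apply Finset.prod_nonneg; intro i _; positivity
  · split_ifs
    · exact mul_nonneg (hp _) (hq _)
    · simp

/-- two-level weights -/
noncomputable def twoLev (K : ℕ) (u v : ℝ) (a : ℕ) : ℝ :=
  if a = 0 then u else if a ≤ K then v / K else 0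

lemma twoLev_nonneg (K : ℕ) (u v : ℝ) (hu : 0 ≤ u) (hv : 0 ≤ v) (a : ℕ) : 0 ≤ twoLev K u v a := by
  unfold twoLev
  split_ifs <;> positivity

lemma twoLev_sum1 (K : ℕ) (hK : 0 < K) (u v : ℝ) : ∑ a ∈ Finset.Icc 1 K, twoLev K u v a = v := by
  have : ∀ a ∈ Finset.Icc 1 K, twoLev K u v a = v / K := by
    intro a ha
    rw [Finset.mem_Icc] at ha
    unfold twoLev
    rw [if_neg (by omega), if_pos ha.2]
  rw [Finset.sum_congr rfl this]
  have : (K : ℝ) ≠ 0 := by positivity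
  simp
  field_simp

lemma range_eq (K : ℕ) : Finset.range (K+1) = insert 0 (Finset.Icc 1 K) := by
  ext a; simp; omega

lemma twoLev_sum (K : ℕ) (hK : 0 < K) (u v : ℝ) :
    ∑ a ∈ Finset.range (K+1), twoLev K u v a = u + v := by
  rw [range_eq, Finset.sum_insert (by simp), twoLev_sum1 K hK]
  simp [twoLev]

lemma twoLev_out (K : ℕ) (u v : ℝ) (a : ℕ) (ha : a ∉ Finset.range (K+1)) : twoLev K u v a = 0 := by
  unfold twoLev
  simp at ha
  rw [if_neg (by omega), if_neg (by omega)]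

/-- fraction of unseen light symbols -/
noncomputable def cfrac (K : ℕ) {n : ℕ} (x : Fin n → ℕ) : ℝ :=
  (((Finset.Icc 1 K).filter (fun a => ∀ i, x i ≠ a)).card : ℝ) / K

lemma missing_eq (K : ℕ) (u v : ℝ) {n : ℕ} (x : Fin n → ℕ) (hx : ∃ i, x i = 0) :
    missingMassNat (twoLev K u v) x = v * cfrac K x := by
  unfold missingMassNat
  rw [tsum_eq_sum (s := Finset.range (K+1))
    (fun a ha => by rw [twoLev_out K u v a ha, zero_mul]),
    range_eq, Finset.sum_insert (by simp)]
  have h0 : ¬ ∀ i, x i ≠ 0 := by push Not; exact hx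
  rw [if_neg h0]
  have : ∀ a ∈ Finset.Icc 1 K, twoLev K u v a * (if ∀ i, x i ≠ a then (1:ℝ) else 0)
      = if ∀ i, x i ≠ a then v / K else 0 := by
    intro a ha
    rw [Finset.mem_Icc] at ha
    unfold twoLev
    rw [if_neg (by omega), if_pos ha.2]
    split_ifs <;> simp
  rw [Finset.sum_congr rfl this, ← Finset.sum_filter, Finset.sum_const, cfrac]
  simp
  ring

lemma cfrac_ge (K : ℕ) {n : ℕ} (hK : K = 16 * n) (hn : 1 ≤ n) (x : Fin n → ℕ) :
    15 / 16 ≤ cfrac K x := by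
  unfold cfrac
  have hs : Finset.Icc 1 K \ Finset.univ.image x ⊆
      (Finset.Icc 1 K).filter (fun a => ∀ i, x i ≠ a) := by
    intro a ha
    simp at ha ⊢
    exact ⟨ha.1, fun i => ha.2 i⟩
  have h1 := Finset.card_le_card hs
  have h2 := Finset.le_card_sdiff (Finset.univ.image x) (Finset.Icc 1 K)
  have h3 : (Finset.univ.image x).card ≤ n := by
    simpa using Finset.card_image_le (s := Finset.univ) (f := x)
  have h4 : 15 * n ≤ ((Finset.Icc 1 K).filter (fun a => ∀ i, x i ≠ a)).card := by
    simp at h2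
    omega
  have h5 : (15 * n : ℝ) ≤ ((Finset.Icc 1 K).filter (fun a => ∀ i, x i ≠ a)).card := by
    exact_mod_cast h4
  have hn' : (0:ℝ) < n := by exact_mod_cast hn
  rw [hK] at h5 ⊢
  push_cast
  rw [le_div_iff₀ (by positivity)]
  linarith

lemma risk_eq (α : ℝ) (p : ℕ → ℝ) (S : Finset ℕ) (hp : ∀ a, a ∉ S → p a = 0) (n : ℕ)
    (est : (Fin n → ℕ) → ℝ) :
    ∑' x : Fin n → ℕ, stickyProb α p x * (missingMassNat p x - est x) ^ 2 =
    ∑ x ∈ Fintype.piFinset (fun _ : Fin n => S),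
      stickyProb α p x * (missingMassNat p x - est x) ^ 2 := by
  apply tsum_eq_sum
  intro x hx
  by_contra h
  exact hx (sticky_zero α p S hp n x (fun h0 => h (by rw [h0, zero_mul])))

lemma twoLev_valid (K : ℕ) (hK : 0 < K) (u v : ℝ) (hu : 0 ≤ u) (hv : 0 ≤ v) (huv : u + v = 1) :
    (∀ a, 0 ≤ twoLev K u v a) ∧ (∃ N, ∀ a, N ≤ a → twoLev K u v a = 0) ∧
      HasSum (twoLev K u v) 1 := by
  refine ⟨twoLev_nonneg K u v hu hv, ⟨K+1, fun a ha => twoLev_out K u v a (by simpa using ha)⟩, ?_⟩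
  rw [← huv, ← twoLev_sum K hK u v]
  exact hasSum_sum_of_ne_finset_zero (fun a ha => twoLev_out K u v a ha)

lemma avoid_eq (K n : ℕ) :
    (Fintype.piFinset (fun _ : Fin n => Finset.range (K+1))).filter (fun x => ¬ ∃ i, x i = 0)
      = Fintype.piFinset (fun _ : Fin n => Finset.Icc 1 K) := by
  ext x
  simp only [Finset.mem_filter, Fintype.mem_piFinset, Finset.mem_range, Finset.mem_Icc, not_exists]
  constructor
  · rintro ⟨h1, h2⟩ i
    have := h1 i
    have := h2 i
    omega
  · intro h
    refine ⟨fun i => ?_, fun i => ?_⟩ <;> have := h i <;> omega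

lemma sum_bound (α : ℝ) (hα0 : 0 ≤ α) (hα1 : α < 1) (m : ℕ) (est : (Fin (m+1) → ℕ) → ℝ)
    (K : ℕ) (hK : K = 16 * (m+1)) (δ s : ℝ) (hδ0 : 0 ≤ δ) (hδ1 : δ ≤ 1/4) (hs0 : 0 ≤ s)
    (hs : s ^ 2 = 1/4 - δ ^ 2)
    (hS : 0 ≤ 2 * s * (α + (1 - α) * (2 * s)) ^ m - s * (α + (1 - α) * s) ^ m) :
    (15/16 * (2 * δ) * (2 * s * (α + (1 - α) * (2 * s)) ^ m - s * (α + (1 - α) * s) ^ m)) ^ 2 ≤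
    ((∑' x, stickyProb α (twoLev K (1/2+δ) (1/2-δ)) x *
        (missingMassNat (twoLev K (1/2+δ) (1/2-δ)) x - est x) ^ 2) +
      (∑' x, stickyProb α (twoLev K (1/2-δ) (1/2+δ)) x *
        (missingMassNat (twoLev K (1/2-δ) (1/2+δ)) x - est x) ^ 2)) * 2 := by
  have hK0 : 0 < K := by omega
  rw [risk_eq α _ (Finset.range (K+1)) (twoLev_out K _ _),
    risk_eq α _ (Finset.range (K+1)) (twoLev_out K _ _)]
  set p0 := twoLev K (1/2+δ) (1/2-δ) with hp0
  set p1 := twoLev K (1/2-δ) (1/2+δ) with hp1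
  set g := twoLev K s s with hg
  have n0 : ∀ a, 0 ≤ p0 a := twoLev_nonneg _ _ _ (by linarith) (by linarith)
  have n1 : ∀ a, 0 ≤ p1 a := twoLev_nonneg _ _ _ (by linarith) (by linarith)
  have ng : ∀ a, 0 ≤ g a := twoLev_nonneg _ _ _ hs0 hs0
  have hsq : ∀ a, g a ^ 2 = p0 a * p1 a := by
    intro a
    simp only [hg, hp0, hp1, twoLev]
    split_ifs
    · rw [hs]; ring
    · rw [div_pow, hs]; ring
    · simp
  have f0 : ∀ x : Fin (m+1) → ℕ, 0 ≤ stickyProb α p0 x := sticky_nonneg α hα0 hα1 p0 n0 _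
  have f1 : ∀ x : Fin (m+1) → ℕ, 0 ≤ stickyProb α p1 x := sticky_nonneg α hα0 hα1 p1 n1 _
  set A := Fintype.piFinset (fun _ : Fin (m+1) => Finset.range (K+1)) with hA
  have s0 : ∑ x ∈ A, stickyProb α p0 x = 1 := by
    rw [hA, sticky_sum, twoLev_sum K hK0]; norm_num
  have s1 : ∑ x ∈ A, stickyProb α p1 x = 1 := by
    rw [hA, sticky_sum, twoLev_sum K hK0]; norm_num
  have sg : ∑ x ∈ A with ∃ i, x i = 0, stickyProb α g x
      = 2 * s * (α + (1 - α) * (2 * s)) ^ m - s * (α + (1 - α) * s) ^ m := by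
    have h1 := Finset.sum_filter_add_sum_filter_not A (fun x => ∃ i, x i = 0)
      (fun x => stickyProb α g x)
    have h2 : ∑ x ∈ A with ¬ ∃ i, x i = 0, stickyProb α g x = s * (α + (1 - α) * s) ^ m := by
      rw [hA, avoid_eq, sticky_sum, twoLev_sum1 K hK0]
    have h3 : ∑ x ∈ A, stickyProb α g x = 2 * s * (α + (1 - α) * (2 * s)) ^ m := by
      rw [hA, sticky_sum, twoLev_sum K hK0, two_mul]
    rw [h2, h3] at h1
    linarith
  rw [← sg, Finset.mul_sum, ← Finset.sum_add_distrib]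
  set L : (Fin (m+1) → ℕ) → ℝ := fun x => stickyProb α p0 x * (missingMassNat p0 x - est x) ^ 2 +
    stickyProb α p1 x * (missingMassNat p1 x - est x) ^ 2 with hL
  have L0 : ∀ x, 0 ≤ L x := fun x =>
    add_nonneg (mul_nonneg (f0 x) (sq_nonneg _)) (mul_nonneg (f1 x) (sq_nonneg _))
  have cs := Finset.sum_sq_le_sum_mul_sum_of_sq_le_mul (A.filter (fun x => ∃ i, x i = 0))
    (r := fun x => 15/16 * (2 * δ) * stickyProb α g x) (f := L)
    (g := fun x => stickyProb α p0 x + stickyProb α p1 x) (fun x _ => L0 x)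
    (fun x _ => add_nonneg (f0 x) (f1 x)) (by
      intro x hx
      have hx0 := (Finset.mem_filter.1 hx).2
      have hc := cfrac_ge K hK (by omega) x
      have hgx := sticky_sq_le α hα0 hα1 p0 p1 g n0 n1 ng hsq _ x
      have h0 := f0 x
      have h1 := f1 x
      simp only [hL]
      rw [hp0, hp1, missing_eq K _ _ x hx0, missing_eq K _ _ x hx0, ← hp0, ← hp1]
      generalize stickyProb α p0 x = a at *
      generalize stickyProb α p1 x = b at *
      generalize stickyProb α g x = c at *
      generalize cfrac K x = t at *
      generalize est x = e at *
      calc (15/16 * (2 * δ) * c) ^ 2 = (15/16)^2 * ((2*δ)^2 * c^2) := by ring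
        _ ≤ t^2 * ((2*δ)^2 * (a*b)) := by gcongr
        _ ≤ _ := by
          have := sq_nonneg (a * ((1/2-δ)*t - e) + b * ((1/2+δ)*t - e))
          nlinarith)
  refine cs.trans ?_
  have hsub := Finset.filter_subset (fun x : Fin (m+1) → ℕ => ∃ i, x i = 0) A
  apply mul_le_mul
  · exact Finset.sum_le_sum_of_subset_of_nonneg hsub (fun x _ _ => L0 x)
  · calc _ ≤ ∑ x ∈ A, (stickyProb α p0 x + stickyProb α p1 x) :=
        Finset.sum_le_sum_of_subset_of_nonneg hsub (fun x _ _ => add_nonneg (f0 x) (f1 x))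
      _ = 2 := by rw [Finset.sum_add_distrib, s0, s1]; norm_num
  · exact Finset.sum_nonneg fun x _ => add_nonneg (f0 x) (f1 x)
  · exact Finset.sum_nonneg fun x _ => L0 x

lemma final_arith (d E Q W : ℝ) (hd0 : 0 ≤ d) (hd : d ≤ 1/16) (hE0 : 0 ≤ E) (hE : E < 1/2)
    (hWE : W ≤ E / 2) (hQ1 : Q ≤ 1) (hQl : 27/32 ≤ Q) :
    d / 2 - E ≤ (15/16)^2 * d * (Q - W)^2 := by
  have h0 : (Q - E/2)^2 ≤ (Q - W)^2 := pow_le_pow_left₀ (by linarith) (by linarith) 2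
  have h1 : (27/32)^2 - E ≤ (Q - W)^2 := by
    have := mul_le_mul_of_nonneg_right hQ1 hE0
    nlinarith [sq_nonneg E]
  have h2 : (15/16)^2 * d * ((27/32)^2 - E) ≤ (15/16)^2 * d * (Q - W)^2 :=
    mul_le_mul_of_nonneg_left h1 (by positivity)
  nlinarith [mul_nonneg hE0 (sub_nonneg.2 hd)]

set_option maxHeartbeats 1000000

/-- Minimax lower bound for missing-mass estimation over geometric sticky channels: for
every estimator `est` there is a finitely supported distribution `p` (on a finite alphabet,
embedded in `ℕ`) such that the mean squared error of `est` for the missing mass of the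
length-`n` stationary sticky chain is at least
`(1/32)/(1 + (n-1)(1-α)) - (1 - 0.5(1-α))^{n-1}`. -/
theorem sticky_missing_mass_minimax_lower_bound
    (α : ℝ) (hα0 : 0 ≤ α) (hα1 : α < 1) (n : ℕ) (hn : 1 ≤ n)
    (est : (Fin n → ℕ) → ℝ) :
    ∃ p : ℕ → ℝ, (∀ a, 0 ≤ p a) ∧ (∃ K, ∀ a, K ≤ a → p a = 0) ∧ HasSum p 1 ∧
      (1 / 32) / (1 + ((n : ℝ) - 1) * (1 - α)) - (1 - 0.5 * (1 - α)) ^ (n - 1)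
        ≤ ∑' x : Fin n → ℕ, stickyProb α p x * (missingMassNat p x - est x) ^ 2 := by
  obtain ⟨m, rfl⟩ : ∃ m, n = m + 1 := ⟨n - 1, by omega⟩
  have hT : (1 + (((m+1 : ℕ) : ℝ) - 1) * (1 - α)) = 1 + m * (1 - α) := by push_cast; ring
  rw [hT, Nat.add_sub_cancel]
  have hβ : 0 < 1 - α := by linarith
  set T : ℝ := 1 + m * (1 - α) with hTd
  have hT1 : 1 ≤ T := by
    have : 0 ≤ (m:ℝ) * (1 - α) := by positivity
    linarith
  set δ : ℝ := √(1 / (16 * T)) with hδ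
  have hδ0 : 0 ≤ δ := Real.sqrt_nonneg _
  have hδ2 : δ ^ 2 = 1 / (16 * T) := Real.sq_sqrt (by positivity)
  have hδT : δ ^ 2 * T = 1 / 16 := by rw [hδ2]; field_simp
  have hδ16 : δ ^ 2 ≤ 1 / 16 := by nlinarith [sq_nonneg δ]
  have hδ1 : δ ≤ 1 / 4 := by nlinarith
  set s : ℝ := √(1/4 - δ^2) with hsd
  have hs0 : 0 ≤ s := Real.sqrt_nonneg _
  have hs : s ^ 2 = 1/4 - δ ^ 2 := Real.sq_sqrt (by linarith)
  have hs1 : s ≤ 1/2 := by nlinarith [sq_nonneg δ]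
  have hG : 1 - 5/2 * δ^2 ≤ 2 * s := by
    apply le_of_sq_le_sq _ (by linarith)
    nlinarith [sq_nonneg δ]
  set E : ℝ := (1 - 0.5 * (1 - α)) ^ m with hE
  set Q : ℝ := 2 * s * (α + (1 - α) * (2 * s)) ^ m with hQ
  set W : ℝ := s * (α + (1 - α) * s) ^ m with hW
  have hE0 : 0 ≤ E := pow_nonneg (by norm_num; linarith) _
  have hWE : W ≤ E / 2 := by
    have h1 : (α + (1 - α) * s) ^ m ≤ E := by
      apply pow_le_pow_left₀ (by positivity)
      norm_num
      nlinarith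
    have : W ≤ 1/2 * E := mul_le_mul hs1 h1 (by positivity) (by norm_num)
    linarith
  have hQ1 : Q ≤ 1 := by
    apply mul_le_one₀ (by linarith) (by positivity)
    apply pow_le_one₀ (by positivity)
    nlinarith
  have hQl : 27/32 ≤ Q := by
    have hB := one_add_mul_le_pow (a := - ((1 - α) * (1 - 2 * s))) (by nlinarith) m
    have e : 1 + - ((1 - α) * (1 - 2 * s)) = α + (1 - α) * (2 * s) := by ring
    rw [e] at hB
    have h1 : 2 * s * (1 + m * - ((1 - α) * (1 - 2 * s))) ≤ Q :=
      mul_le_mul_of_nonneg_left hB (by linarith)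
    have h2 : 1 - (1 - 2 * s) * T ≤ 2 * s * (1 + m * - ((1 - α) * (1 - 2 * s))) := by
      have : 0 ≤ (m:ℝ) * (1 - α) * (1 - 2*s) * (1 - 2 * s) := by
        have : 0 ≤ 1 - 2 * s := by linarith
        positivity
      rw [hTd]
      nlinarith
    have h3 : (1 - 2 * s) * T ≤ 5/2 * δ^2 * T := mul_le_mul_of_nonneg_right (by linarith) (by linarith)
    linarith
  have goalval : (1/32) / T = δ ^ 2 / 2 := by rw [hδ2]; field_simp; norm_num
  rw [goalval]
  by_cases hbig : 1/2 ≤ E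
  · refine ⟨twoLev 1 (1/2+δ) (1/2-δ), ?_⟩
    obtain ⟨h1, h2, h3⟩ := twoLev_valid 1 one_pos (1/2+δ) (1/2-δ) (by linarith) (by linarith) (by ring)
    refine ⟨h1, h2, h3, ?_⟩
    have : 0 ≤ ∑' x : Fin (m+1) → ℕ, stickyProb α (twoLev 1 (1/2+δ) (1/2-δ)) x *
        (missingMassNat (twoLev 1 (1/2+δ) (1/2-δ)) x - est x) ^ 2 :=
      tsum_nonneg fun x => mul_nonneg (sticky_nonneg α hα0 hα1 _ h1 _ x) (sq_nonneg _)
    linarith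
  push Not at hbig
  have hS : 0 ≤ Q - W := by linarith
  have main := sum_bound α hα0 hα1 m est (16 * (m+1)) rfl δ s hδ0 hδ1 hs0 hs hS
  obtain ⟨a1, a2, a3⟩ := twoLev_valid (16 * (m+1)) (by omega) (1/2+δ) (1/2-δ) (by linarith) (by linarith) (by ring)
  obtain ⟨b1, b2, b3⟩ := twoLev_valid (16 * (m+1)) (by omega) (1/2-δ) (1/2+δ) (by linarith) (by linarith) (by ring)
  have key : δ^2 / 2 - E ≤ (15/16)^2 * δ^2 * (Q - W)^2 :=
    final_arith (δ^2) E Q W (sq_nonneg δ) hδ16 hE0 hbig hWE hQ1 hQl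
  have e : (15/16 * (2 * δ) * (Q - W)) ^ 2 = 4 * ((15/16)^2 * δ^2 * (Q - W)^2) := by ring
  rw [e] at main
  by_contra hcon
  push Not at hcon
  have c1 := hcon _ a1 a2 a3
  have c2 := hcon _ b1 b2 b3
  linarith
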